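/- The map ℕ^{V₀} → G sending c to σ(c + e^T) (where e^T is the identity of the sandpile group G) is surjective and descends to a group isomorphism ℤ^{V₀}/Λ ≅ G, where Λ is the lattice spanned by the rows of the toppling matrix Δ; in particular the order of G equals det(Δ). -/

import Mathlib

namespace SandpilePaper

variable {V : Type*} [Fintype V] [DecidableEq V]

/-- Configurations: assignments of numbers of grains to ordinary (non-sink) vertices. -/
abbrev Conf (s : V) : Type _ := {i : V // i ≠ s} → ℕ

/-- The degree of a vertex: `deg i = ∑ j, e i j`. -/
def deg (e : V → V → ℕ) (i : V) : ℕ := ∑ j, e i j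

/-- Toppling the (unstable) vertex `i`. -/
def toppleAt (e : V → V → ℕ) (s : V) (i : {i : V // i ≠ s}) (u : Conf s) : Conf s :=
  fun j => if j = i then u i - deg e i.1 + e i.1 i.1 else u j + e i.1 j.1

/-- One toppling step: some unstable vertex topples. -/
def Topple (e : V → V → ℕ) (s : V) (u v : Conf s) : Prop :=
  ∃ i : {i : V // i ≠ s}, deg e i.1 ≤ u i ∧ v = toppleAt e s i u

/-- A configuration is stable if every ordinary vertex has fewer grains than its degree. -/
def Stable (e : V → V → ℕ) (s : V) (u : Conf s) : Prop :=
  ∀ j : {i : V // i ≠ s}, u j < deg e j.1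

/-- The underlying simple graph: edges between distinct vertices with positive multiplicity. -/
def graph (e : V → V → ℕ) : SimpleGraph V := SimpleGraph.fromRel fun i j => 0 < e i j

/-- `σ` is a stabilization map: `σ u` is stable and reached from `u` by finitely many topplings. -/
def IsStabilization (e : V → V → ℕ) (s : V) (σ : Conf s → Conf s) : Prop :=
  ∀ u, Stable e s (σ u) ∧ Relation.ReflTransGen (Topple e s) u (σ u)

/-- A stable configuration `u` is recurrent if every configuration can reach it. -/
def Recurrent (e : V → V → ℕ) (s : V) (σ : Conf s → Conf s) (u : Conf s) : Prop :=
  Stable e s u ∧ ∀ v : Conf s, ∃ w : Conf s, σ (v + w) = u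

/-- Apply a sequence of topplings. -/
def applySeq (e : V → V → ℕ) (s : V) (u : Conf s) : List {i : V // i ≠ s} → Conf s
  | [] => u
  | i :: L => applySeq e s (toppleAt e s i u) L

/-- A toppling sequence is valid if each toppled vertex is unstable when toppled. -/
def ValidSeq (e : V → V → ℕ) (s : V) (u : Conf s) : List {i : V // i ≠ s} → Prop
  | [] => True
  | i :: L => deg e i.1 ≤ u i ∧ ValidSeq e s (toppleAt e s i u) L

/-- `succeq e s i j` means `i ⪰ j`: `j` lies on the unique path from `i` to the sink `s`. -/
def succeq (e : V → V → ℕ) (s i j : V) : Prop :=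
  (graph e).dist i s = (graph e).dist i j + (graph e).dist j s

noncomputable instance (e : V → V → ℕ) (s i j : V) : Decidable (succeq e s i j) := Nat.decEq _ _

/-- `p` assigns to each ordinary vertex its parent: its neighbor on the path to the sink. -/
def IsParent (e : V → V → ℕ) (s : V) (p : {i : V // i ≠ s} → V) : Prop :=
  ∀ j : {i : V // i ≠ s}, (graph e).Adj j.1 (p j) ∧
    (graph e).dist (p j) s + 1 = (graph e).dist j.1 s

/-- The set `{i : i ⪰ j}`. -/
noncomputable def descendants (e : V → V → ℕ) (s : V) (j : {i : V // i ≠ s}) :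
    Finset {i : V // i ≠ s} :=
  Finset.univ.filter fun i => succeq e s i.1 j.1

/-- The set `{i : i ≻ j}`. -/
noncomputable def strictDescendants (e : V → V → ℕ) (s : V) (j : {i : V // i ≠ s}) :
    Finset {i : V // i ≠ s} :=
  Finset.univ.filter fun i => i ≠ j ∧ succeq e s i.1 j.1

/-- `j` is a leaf: its parent is its only neighbor in the underlying tree. -/
def IsLeaf (e : V → V → ℕ) (s : V) (p : {i : V // i ≠ s} → V) (j : {i : V // i ≠ s}) : Prop :=
  ∀ k : V, (graph e).Adj j.1 k → k = p j

/-- Rows of the toppling matrix `Δ`. -/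
def deltaRow (e : V → V → ℕ) (s : V) (i j : {i : V // i ≠ s}) : ℤ :=
  if i = j then (deg e i.1 : ℤ) - (e i.1 i.1 : ℤ) else -(e i.1 j.1 : ℤ)

/-- The lattice `Λ` spanned by the rows of the toppling matrix. -/
def lattice (e : V → V → ℕ) (s : V) : AddSubgroup ({i : V // i ≠ s} → ℤ) :=
  AddSubgroup.closure (Set.range (deltaRow e s))

/-- The map `φ(u)_j = ∑_{i ⪰ j} u_i (mod e_{j,p(j)})`. -/
noncomputable def phi (e : V → V → ℕ) (s : V) (p : {i : V // i ≠ s} → V) (u : Conf s)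
    (j : {i : V // i ≠ s}) : ZMod (e j.1 (p j)) :=
  ∑ i ∈ descendants e s j, (u i : ZMod (e j.1 (p j)))

/-- The map `φ` on integer vectors. -/
noncomputable def phiZ (e : V → V → ℕ) (s : V) (p : {i : V // i ≠ s} → V) (u : {i : V // i ≠ s} → ℤ)
    (j : {i : V // i ≠ s}) : ZMod (e j.1 (p j)) :=
  ∑ i ∈ descendants e s j, (u i : ZMod (e j.1 (p j)))


section Dynamics

variable {e : V → V → ℕ} {s : V}

/-- Toppling two distinct unstable vertices can be done in either order. -/
theorem toppleAt_comm (u : Conf s) {i j : {i : V // i ≠ s}} (hij : i ≠ j)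
    (hi : deg e i.1 ≤ u i) (hj : deg e j.1 ≤ u j) :
    toppleAt e s j (toppleAt e s i u) = toppleAt e s i (toppleAt e s j u) := by
  funext k
  by_cases hki : k = i
  · subst hki
    simp only [toppleAt, hij, hij.symm, if_true, if_false]
    omega
  · by_cases hkj : k = j
    · subst hkj
      simp only [toppleAt, hki, hij, if_true, if_false]
      omega
    · simp only [toppleAt, hki, hkj, if_false]
      omega

theorem le_toppleAt_of_ne (u : Conf s) {i j : {i : V // i ≠ s}} (hij : j ≠ i) :
    u j ≤ toppleAt e s i u j := by
  simp [toppleAt, hij]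

theorem topple_diamond (a b c : Conf s) (hab : Topple e s a b) (hac : Topple e s a c) :
    ∃ d, Relation.ReflGen (Topple e s) b d ∧ Relation.ReflTransGen (Topple e s) c d := by
  obtain ⟨i, hi, rfl⟩ := hab
  obtain ⟨j, hj, rfl⟩ := hac
  by_cases hij : i = j
  · subst hij
    exact ⟨_, .refl, .refl⟩
  · exact ⟨_, .single ⟨j, hj.trans (le_toppleAt_of_ne a (Ne.symm hij)), rfl⟩,
      .single ⟨i, hi.trans (le_toppleAt_of_ne a hij), toppleAt_comm a hij hi hj⟩⟩

theorem Stable.eq_of_reflTransGen {u v : Conf s} (hu : Stable e s u)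
    (h : Relation.ReflTransGen (Topple e s) u v) : u = v := by
  rcases h.cases_head with h | ⟨w, ⟨i, hi, -⟩, -⟩
  · exact h
  · exact absurd (hu i) (not_lt.2 hi)

theorem Stable.unique {u v w : Conf s} (hv : Stable e s v) (hw : Stable e s w)
    (huv : Relation.ReflTransGen (Topple e s) u v)
    (huw : Relation.ReflTransGen (Topple e s) u w) : v = w := by
  obtain ⟨d, hvd, hwd⟩ := Relation.church_rosser topple_diamond huv huw
  rw [hv.eq_of_reflTransGen hvd, hw.eq_of_reflTransGen hwd]

theorem Topple.add_right {u v : Conf s} (h : Topple e s u v) (w : Conf s) :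
    Topple e s (u + w) (v + w) := by
  obtain ⟨i, hi, rfl⟩ := h
  refine ⟨i, hi.trans (Nat.le_add_right _ _), ?_⟩
  funext k
  simp only [toppleAt, Pi.add_apply]
  split_ifs with hk
  · subst hk
    omega
  · omega

theorem reflTransGen_topple_add_right {u v : Conf s}
    (h : Relation.ReflTransGen (Topple e s) u v) (w : Conf s) :
    Relation.ReflTransGen (Topple e s) (u + w) (v + w) :=
  h.lift (· + w) fun _ _ hab => hab.add_right w

/-- The vector of natural numbers `u`, viewed as an integer vector. -/
def toInt {ι : Type*} (u : ι → ℕ) : ι → ℤ := fun i => (u i : ℤ)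

theorem toInt_add {ι : Type*} (u v : ι → ℕ) : toInt (u + v) = toInt u + toInt v := by
  funext i
  simp [toInt]

theorem toInt_injective {ι : Type*} : Function.Injective (toInt : (ι → ℕ) → ι → ℤ) := fun u v h => by
  funext i
  simpa [toInt] using congrFun h i

theorem toInt_sub_toInt_toppleAt {u : Conf s} {i : {i : V // i ≠ s}} (hi : deg e i.1 ≤ u i) :
    toInt u - toInt (toppleAt e s i u) = deltaRow e s i := by
  funext k
  by_cases hk : k = i
  · subst hk
    simp only [toInt, toppleAt, deltaRow, Pi.sub_apply, if_true]
    omega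
  · simp [toInt, toppleAt, deltaRow, hk, Ne.symm hk]

theorem toInt_sub_mem_lattice {u v : Conf s} (h : Relation.ReflTransGen (Topple e s) u v) :
    toInt u - toInt v ∈ lattice e s := by
  induction h with
  | refl => simp [zero_mem]
  | tail _ h ih =>
    obtain ⟨i, hi, rfl⟩ := h
    rw [← sub_add_sub_cancel]
    refine add_mem ih ?_
    rw [toInt_sub_toInt_toppleAt hi]
    exact AddSubgroup.subset_closure ⟨i, rfl⟩

namespace IsStabilization

variable {σ : Conf s → Conf s}

theorem apply_eq (hσ : IsStabilization e s σ) {u v : Conf s}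
    (h : Relation.ReflTransGen (Topple e s) u v) : σ u = σ v :=
  (hσ u).1.unique (hσ v).1 (hσ u).2 (h.trans (hσ v).2)

theorem apply_add (hσ : IsStabilization e s σ) (u v : Conf s) : σ (σ u + v) = σ (u + v) :=
  (hσ.apply_eq (reflTransGen_topple_add_right (hσ u).2 v)).symm

theorem mk_apply (hσ : IsStabilization e s σ) (u : Conf s) :
    (QuotientAddGroup.mk (toInt (σ u)) : _ ⧸ lattice e s) = QuotientAddGroup.mk (toInt u) := by
  rw [QuotientAddGroup.eq, neg_add_eq_sub]
  exact toInt_sub_mem_lattice (hσ u).2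

theorem recurrent_add (hσ : IsStabilization e s σ) {u : Conf s} (hu : Recurrent e s σ u)
    (c : Conf s) : Recurrent e s σ (σ (u + c)) := by
  refine ⟨(hσ _).1, fun v => ?_⟩
  obtain ⟨w, rfl⟩ := hu.2 v
  exact ⟨w + c, by rw [hσ.apply_add, add_assoc]⟩

/-- Lattice-equivalent configurations stabilize alike once enough grains are added to both. -/
theorem exists_apply_add_eq (hσ : IsStabilization e s σ) {z : {i : V // i ≠ s} → ℤ}
    (hz : z ∈ lattice e s) :
    ∀ u v : Conf s, toInt u - toInt v = z → ∃ x, σ (u + x) = σ (v + x) := by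
  induction hz using AddSubgroup.closure_induction with
  | mem z hz =>
    obtain ⟨i, rfl⟩ := hz
    intro u v huv
    let d : Conf s := fun j => deg e j.1
    refine ⟨d, hσ.apply_eq (.single ⟨i, Nat.le_add_left _ _, ?_⟩)⟩
    apply toInt_injective
    have hi : deg e i.1 ≤ (u + d) i := Nat.le_add_left _ _
    rw [← sub_right_inj, toInt_sub_toInt_toppleAt hi, toInt_add, toInt_add,
      add_sub_add_right_eq_sub, huv]
  | zero =>
    intro u v huv
    rw [sub_eq_zero] at huv
    exact ⟨0, by rw [toInt_injective huv]⟩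
  | add z₁ z₂ _ _ ih₁ ih₂ =>
    intro u v huv
    let b : Conf s := fun i => (z₁ i).natAbs
    let m : Conf s := fun i => ((u i : ℤ) + b i - z₁ i).toNat
    have hm : toInt m = toInt u + toInt b - z₁ := by
      funext i
      simp only [toInt, m, b, Pi.add_apply, Pi.sub_apply]
      omega
    obtain ⟨x, hx⟩ := ih₁ (u + b) m (by rw [hm, toInt_add, sub_sub_cancel])
    obtain ⟨y, hy⟩ := ih₂ m (v + b) (by
      rw [hm, toInt_add, sub_eq_iff_eq_add.1 huv]
      abel)
    refine ⟨b + x + y, ?_⟩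
    calc σ (u + (b + x + y)) = σ (u + b + x + y) := by simp only [add_assoc]
      _ = σ (m + x + y) := by rw [← hσ.apply_add, hx, hσ.apply_add]
      _ = σ (m + y + x) := by rw [add_right_comm]
      _ = σ (v + b + y + x) := by rw [← hσ.apply_add, hy, hσ.apply_add]
      _ = σ (v + (b + x + y)) := by rw [add_right_comm (v + b)]; simp only [add_assoc]
  | neg z _ ih =>
    intro u v huv
    obtain ⟨x, hx⟩ := ih v u (by rw [← neg_sub, huv, neg_neg])
    exact ⟨x, hx.symm⟩

/-- The class of an identity element in the quotient by the lattice is trivial. -/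
theorem mk_identity (hσ : IsStabilization e s σ) {eT : Conf s} (h : σ (eT + eT) = eT) :
    (QuotientAddGroup.mk (toInt eT) : _ ⧸ lattice e s) = 0 := by
  have h₂ := hσ.mk_apply (eT + eT)
  rw [h, toInt_add, QuotientAddGroup.mk_add] at h₂
  exact left_eq_add.1 h₂

/-- Recurrent configurations are determined by their class modulo the lattice. -/
theorem eq_of_mk_eq (hσ : IsStabilization e s σ) {eT : Conf s}
    (heT : Recurrent e s σ eT ∧ ∀ u, Recurrent e s σ u → σ (eT + u) = u) {u v : Conf s}
    (hu : Recurrent e s σ u) (hv : Recurrent e s σ v)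
    (h : (QuotientAddGroup.mk (toInt u) : _ ⧸ lattice e s) = QuotientAddGroup.mk (toInt v)) :
    u = v := by
  rw [eq_comm, QuotientAddGroup.eq, neg_add_eq_sub] at h
  obtain ⟨x, hx⟩ := hσ.exists_apply_add_eq h u v rfl
  obtain ⟨w, hw⟩ := heT.1.2 x
  have key : ∀ a, Recurrent e s σ a → σ (σ (a + x) + w) = a := fun a ha => by
    rw [hσ.apply_add, add_assoc, add_comm, ← hσ.apply_add, hw, heT.2 a ha]
  rw [← key u hu, ← key v hv, hx]

end IsStabilization

end Dynamics

section Determinant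

variable {e : V → V → ℕ} {s : V}

theorem sum_deltaRow_mul (y : V → ℝ) (hy : y s = 0) (i : {i : V // i ≠ s}) :
    ∑ j, (deltaRow e s i j : ℝ) * y j.1 = ∑ j : V, (e i.1 j : ℝ) * (y i.1 - y j) := by
  have h : ∀ j : {i : V // i ≠ s}, (deltaRow e s i j : ℝ) * y j.1
      = (if i = j then (deg e i.1 : ℝ) * y j.1 else 0) - (e i.1 j.1 : ℝ) * y j.1 := by
    intro j
    simp only [deltaRow]
    split_ifs with hij
    · subst hij
      push_cast
      ring
    · push_cast
      ring
  simp only [h, Finset.sum_sub_distrib, Finset.sum_ite_eq, Finset.mem_univ, if_true, mul_sub,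
    ← Finset.sum_mul, deg, Nat.cast_sum]
  rw [Fintype.sum_eq_add_sum_subtype_ne (fun j => (e i.1 j : ℝ) * y j) s, hy, mul_zero, zero_add]

/-- The quadratic form of a symmetric weighted graph Laplacian is its Dirichlet energy. -/
theorem two_mul_sum_mul_sum {ι : Type*} [Fintype ι] {e : ι → ι → ℕ}
    (hsym : ∀ i j, e i j = e j i) (y : ι → ℝ) :
    2 * ∑ i, y i * ∑ j, (e i j : ℝ) * (y i - y j) = ∑ i, ∑ j, (e i j : ℝ) * (y i - y j) ^ 2 := by
  have h : ∑ i, y i * ∑ j, (e i j : ℝ) * (y i - y j)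
      = ∑ i, ∑ j, (e i j : ℝ) * (y j * (y j - y i)) := by
    simp only [Finset.mul_sum]
    rw [Finset.sum_comm]
    refine Finset.sum_congr rfl fun i _ => Finset.sum_congr rfl fun j _ => ?_
    rw [hsym j i]
    ring
  rw [two_mul]
  nth_rewrite 2 [h]
  simp only [Finset.mul_sum, ← Finset.sum_add_distrib]
  refine Finset.sum_congr rfl fun i _ => Finset.sum_congr rfl fun j _ => ?_
  ring

theorem eq_zero_of_energy_eq_zero {ι : Type*} [Fintype ι] {e : ι → ι → ℕ} {s : ι}
    (hsym : ∀ i j, e i j = e j i) (hconn : (graph e).Connected) {y : ι → ℝ} (hy : y s = 0)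
    (h : ∑ i, ∑ j, (e i j : ℝ) * (y i - y j) ^ 2 = 0) : y = 0 := by
  have hterm : ∀ i j, (e i j : ℝ) * (y i - y j) ^ 2 = 0 := by
    intro i j
    rw [Finset.sum_eq_zero_iff_of_nonneg fun i _ => Finset.sum_nonneg fun j _ => by positivity] at h
    exact (Finset.sum_eq_zero_iff_of_nonneg fun j _ => by positivity).1 (h i (Finset.mem_univ i)) j
      (Finset.mem_univ j)
  have hadj : ∀ i j, (graph e).Adj i j → y i = y j := by
    intro i j hij
    have hpos : 0 < e i j := by
      rcases (SimpleGraph.fromRel_adj _ _ _).1 hij with ⟨-, h | h⟩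
      · exact h
      · rwa [hsym]
    have := hterm i j
    simpa [hpos.ne', sub_eq_zero] using this
  funext i
  obtain ⟨p⟩ := hconn.preconnected i s
  rw [Pi.zero_apply, ← hy]
  induction p with
  | nil => rfl
  | cons hab _ ih => exact (hadj _ _ hab).trans (ih hy)

theorem posDef_deltaRow (hsym : ∀ i j : V, e i j = e j i) (hconn : (graph e).Connected) :
    ((Matrix.of (deltaRow e s)).map (Int.cast : ℤ → ℝ)).PosDef := by
  refine Matrix.PosDef.of_dotProduct_mulVec_pos ?_ fun x hx => ?_
  · ext i j
    by_cases hij : i = j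
    · simp [hij]
    · simp [deltaRow, hij, Ne.symm hij, hsym i.1 j.1]
  · let y : V → ℝ := fun i => if hi : i ≠ s then x ⟨i, hi⟩ else 0
    have hys : y s = 0 := by simp [y]
    have hyx : ∀ i : {i : V // i ≠ s}, y i.1 = x i := fun i => by simp [y, i.2]
    have hform : star x ⬝ᵥ ((Matrix.of (deltaRow e s)).map (Int.cast : ℤ → ℝ)).mulVec x
        = ∑ i, y i * ∑ j, (e i j : ℝ) * (y i - y j) := by
      rw [Fintype.sum_eq_add_sum_subtype_ne (fun i => y i * ∑ j, (e i j : ℝ) * (y i - y j)) s, hys,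
        zero_mul, zero_add]
      refine Finset.sum_congr rfl fun i _ => ?_
      rw [← sum_deltaRow_mul y hys i, hyx]
      simp only [hyx, Matrix.mulVec, dotProduct, Matrix.map_apply, Matrix.of_apply, star_trivial]
    have hnonneg : 0 ≤ ∑ i, ∑ j, (e i j : ℝ) * (y i - y j) ^ 2 :=
      Finset.sum_nonneg fun i _ => Finset.sum_nonneg fun j _ => by positivity
    have hne : ∑ i, ∑ j, (e i j : ℝ) * (y i - y j) ^ 2 ≠ 0 := fun h => hx <| by
      funext i
      rw [← hyx, eq_zero_of_energy_eq_zero hsym hconn hys h]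
      rfl
    rw [hform]
    linarith [two_mul_sum_mul_sum hsym y, lt_of_le_of_ne hnonneg hne.symm]

theorem det_deltaRow_pos (hsym : ∀ i j : V, e i j = e j i) (hconn : (graph e).Connected) :
    0 < (Matrix.of (deltaRow e s)).det := by
  have h := (posDef_deltaRow (s := s) hsym hconn).det_pos
  have hcast := (Int.castRingHom ℝ).map_det (Matrix.of (deltaRow e s))
  rw [RingHom.mapMatrix_apply, Int.coe_castRingHom] at hcast
  rw [← hcast] at h
  exact Int.cast_pos.1 h

end Determinant

/-- The index of the lattice spanned by the rows of a nonsingular integer matrix. -/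
theorem card_quotient_closure_range_row {ι : Type*} [Fintype ι] [DecidableEq ι]
    (A : Matrix ι ι ℤ) (hA : A.det ≠ 0) :
    Nat.card ((ι → ℤ) ⧸ AddSubgroup.closure (Set.range A.row)) = A.det.natAbs := by
  have hli : LinearIndependent ℤ A.row := A.linearIndependent_rows_of_det_ne_zero hA
  have h := Submodule.natAbs_det_basis_change (Pi.basisFun ℤ ι) _ (Module.Basis.span hli)
  have hrow : (Subtype.val ∘ Module.Basis.span hli : ι → ι → ℤ) = A.row := by
    funext i
    simp [Module.Basis.span_apply]
  rw [hrow, Pi.basisFun_det_apply] at h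
  rw [← Submodule.span_int_eq_addSubgroupClosure]
  exact h.symm

theorem exists_mk_toInt_eq {e : V → V → ℕ} {s : V} [(lattice e s).FiniteIndex]
    (x : {i : V // i ≠ s} → ℤ) :
    ∃ c : Conf s,
      (QuotientAddGroup.mk (toInt c) : _ ⧸ lattice e s) = QuotientAddGroup.mk x := by
  set n := (lattice e s).index
  have hn : 0 < n := Nat.pos_of_ne_zero AddSubgroup.FiniteIndex.index_ne_zero
  let y : {i : V // i ≠ s} → ℤ := fun i => |x i|
  have hnonneg : ∀ i, 0 ≤ (x + n • y) i := fun i => by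
    have h : |x i| ≤ n * |x i| := le_mul_of_one_le_left (abs_nonneg _) (by exact_mod_cast hn)
    rw [Pi.add_apply, Pi.smul_apply, nsmul_eq_mul]
    linarith [neg_abs_le (x i)]
  have hc : toInt (fun i => ((x + n • y) i).toNat : Conf s) = x + n • y := by
    funext i
    exact Int.toNat_of_nonneg (hnonneg i)
  refine ⟨fun i => ((x + n • y) i).toNat, ?_⟩
  rw [hc, eq_comm, QuotientAddGroup.eq, neg_add_cancel_left]
  exact (lattice e s).nsmul_index_mem y

theorem stmt_2 (e : V → V → ℕ) (s : V) (hsym : ∀ i j : V, e i j = e j i)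
    (hconn : (graph e).Connected)
    (σ : Conf s → Conf s) (hσ : IsStabilization e s σ)
    (eT : Conf s)
    (heT : Recurrent e s σ eT ∧ ∀ u, Recurrent e s σ u → σ (eT + u) = u) :
    (∀ u, Recurrent e s σ u → ∃ c : Conf s, σ (c + eT) = u) ∧
    (∃ ψ : (({i : V // i ≠ s} → ℤ) ⧸ lattice e s) ≃ {u : Conf s // Recurrent e s σ u},
      (∀ c : Conf s, (ψ (QuotientAddGroup.mk fun i => (c i : ℤ))).1 = σ (c + eT)) ∧
      (∀ x y, (ψ (x + y)).1 = σ ((ψ x).1 + (ψ y).1))) ∧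
    (Nat.card {u : Conf s // Recurrent e s σ u} : ℤ) = Matrix.det (Matrix.of (deltaRow e s)) := by
  have hcard : Nat.card (_ ⧸ lattice e s) = (Matrix.of (deltaRow e s)).det.natAbs :=
    card_quotient_closure_range_row _ (det_deltaRow_pos hsym hconn).ne'
  have hfin : (lattice e s).FiniteIndex := ⟨by
    rw [AddSubgroup.index, hcard, Int.natAbs_ne_zero]
    exact (det_deltaRow_pos hsym hconn).ne'⟩
  let f : {u : Conf s // Recurrent e s σ u} → (_ ⧸ lattice e s) :=
    fun u => QuotientAddGroup.mk (toInt u.1)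
  have hrec : ∀ c, Recurrent e s σ (σ (c + eT)) := fun c => by
    rw [add_comm]
    exact hσ.recurrent_add heT.1 c
  have hf : ∀ c, f ⟨_, hrec c⟩ = QuotientAddGroup.mk (toInt c) := fun c => by
    change QuotientAddGroup.mk (toInt (σ _)) = _
    rw [hσ.mk_apply, toInt_add, QuotientAddGroup.mk_add, hσ.mk_identity (heT.2 eT heT.1), add_zero]
  have hinj : Function.Injective f := fun u v h =>
    Subtype.ext (hσ.eq_of_mk_eq heT u.2 v.2 h)
  have hsurj : Function.Surjective f := fun x => by
    obtain ⟨x, rfl⟩ := QuotientAddGroup.mk_surjective x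
    obtain ⟨c, hc⟩ := exists_mk_toInt_eq (e := e) x
    exact ⟨_, (hf c).trans hc⟩
  let ψ := (Equiv.ofBijective f ⟨hinj, hsurj⟩).symm
  have hψ : ∀ x u, f u = x → ψ x = u := fun x u h =>
    (Equiv.symm_apply_eq _).2 h.symm
  have hfψ : ∀ x, f (ψ x) = x := (Equiv.ofBijective f ⟨hinj, hsurj⟩).apply_symm_apply
  refine ⟨fun u hu => ⟨u, by rw [add_comm, heT.2 u hu]⟩, ⟨ψ, fun c => ?_, fun x y => ?_⟩, ?_⟩
  · exact congrArg Subtype.val (hψ _ _ (hf c))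
  · rw [hψ (x + y) ⟨_, hσ.recurrent_add (ψ x).2 (ψ y).1⟩]
    change QuotientAddGroup.mk (toInt (σ _)) = _
    rw [hσ.mk_apply, toInt_add, QuotientAddGroup.mk_add]
    exact congrArg₂ (· + ·) (hfψ x) (hfψ y)
  · rw [← Nat.card_congr ψ, hcard]
    exact Int.natAbs_of_nonneg (det_deltaRow_pos hsym hconn).le

end SandpilePaper
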